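/- Let a, b, y be real numbers with a ≥ 0, b ≥ 0, 0 ≤ y ≤ a + b, and a + b ≤ 1/2. Then negMulLog(y) ≤ 2·negMulLog(a) + 2·negMulLog(b) + 2·(a + b)·log 2. -/

import Mathlib

open Real

/-- `Real.negMulLog` is subadditive on the nonnegative reals. -/
lemma negMulLog_add_le {a b : ℝ} (ha : 0 ≤ a) (hb : 0 ≤ b) :
    negMulLog (a + b) ≤ negMulLog a + negMulLog b := by
  have mul_log_le_mul_log_add {x z : ℝ} (hx : 0 ≤ x) (hz : 0 ≤ z) :
      x * log x ≤ x * log (x + z) := by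
    rcases hx.eq_or_lt with rfl | hx
    · simp
    · gcongr
      linarith
  have h₁ := mul_log_le_mul_log_add ha hb
  have h₂ := mul_log_le_mul_log_add hb ha
  rw [add_comm b a] at h₂
  simp only [negMulLog]
  linarith

/-- The graph of `Real.negMulLog` lies below its tangent line at any `s > 0`. -/
lemma negMulLog_le_tangent {s y : ℝ} (hs : 0 < s) (hy : 0 ≤ y) :
    negMulLog y ≤ y * (-log s) + (s - y) := by
  rcases hy.eq_or_lt with rfl | hy
  · simpa using hs.le
  · have h := mul_le_mul_of_nonneg_left (log_le_sub_one_of_pos (div_pos hs hy)) hy.le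
    rw [log_div hs.ne' hy.ne', mul_sub y (s / y), mul_div_cancel₀ _ hy.ne'] at h
    simp only [negMulLog]
    linarith

/-- If `0 ≤ y ≤ a + b ≤ 1/2` with `a, b ≥ 0`, then
`negMulLog y ≤ 2 negMulLog a + 2 negMulLog b + 2 (a+b) log 2`. -/
theorem negMulLog_le_of_le_add (a b y : ℝ) (ha : 0 ≤ a) (hb : 0 ≤ b)
    (hy0 : 0 ≤ y) (hy : y ≤ a + b) (hab : a + b ≤ 1 / 2) :
    Real.negMulLog y ≤
      2 * Real.negMulLog a + 2 * Real.negMulLog b + 2 * (a + b) * Real.log 2 := by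
  have hadd := negMulLog_add_le ha hb
  suffices h : negMulLog y ≤ 2 * negMulLog (a + b) + 2 * (a + b) * log 2 by linarith
  generalize a + b = s at hy hab
  rcases (hy0.trans hy).eq_or_lt with rfl | hs
  · simp [le_antisymm hy hy0]
  have hlog : log 2 ≤ -log s := by
    have h := log_le_log hs hab
    rw [one_div, log_inv] at h
    linarith
  have htwo := log_two_gt_d9
  have htan := negMulLog_le_tangent hs hy0
  have hmono : y * (-log s) ≤ s * (-log s) := by
    gcongr
    linarith
  have hone : s * 1 ≤ s * (-log s + 2 * log 2) := by
    gcongr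
    linarith
  have hdef : negMulLog s = s * (-log s) := by simp [negMulLog]
  linarith
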